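/- Let n ≥ 1 and let F : ℂ → ℂ be defined by F(z) = z·log(|z|²) for z ≠ 0 and F(0) = 0. Let u : ℝ × ℝⁿ → ℂ be a smooth solution of the defocusing logarithmic NLS i∂_t u + Δ_x u = F(u) which is exponentially localized (there exist C, γ > 0 with |∂^α u(t,x)| ≤ C e^{-γ|x|} for all (t,x) and all space-time derivatives ∂^α of order at most 2) and time-periodic with some period T > 0. Then u is identically zero. -/

import Mathlib

open MeasureTheory Real Complex Function

/-- Partial derivative in the `j`-th coordinate direction. -/
noncomputable def pd {n : ℕ} (f : EuclideanSpace ℝ (Fin n) → ℂ) (j : Fin n)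
    (x : EuclideanSpace ℝ (Fin n)) : ℂ :=
  fderiv ℝ f x (EuclideanSpace.single j 1)

/-- Spatial Laplacian. -/
noncomputable def lap {n : ℕ} (f : EuclideanSpace ℝ (Fin n) → ℂ)
    (x : EuclideanSpace ℝ (Fin n)) : ℂ :=
  ∑ j, pd (fun y => pd f j y) j x

/-- The logarithmic nonlinearity `F(z) = z log(|z|²)`, extended by `0` at `z = 0`. -/
noncomputable def Flog (z : ℂ) : ℂ :=
  if z = 0 then 0 else z * (Real.log (‖z‖ ^ 2) : ℂ)

/-- Measurable functions of space-time decaying faster than any polynomial in space, uniformly in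
time. -/
def RapidDecay {E F : Type*} [NormedAddCommGroup E] [MeasurableSpace E] [NormedAddCommGroup F]
    [MeasurableSpace F] (f : ℝ × E → F) : Prop :=
  Measurable f ∧ ∀ k : ℕ, ∃ C, ∀ z, (1 + ‖z.2‖) ^ k * ‖f z‖ ≤ C

namespace RapidDecay

section

variable {E F G : Type*} [NormedAddCommGroup E] [MeasurableSpace E]
  [NormedAddCommGroup F] [MeasurableSpace F] [NormedAddCommGroup G] [MeasurableSpace G]

theorem of_le {f : ℝ × E → F} {g : ℝ × E → G} (hg : RapidDecay g) (hf : Measurable f) {K : ℝ}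
    (hK : 0 ≤ K) (h : ∀ z, ‖f z‖ ≤ K * ‖g z‖) : RapidDecay f := by
  refine ⟨hf, fun k => ?_⟩
  obtain ⟨C, hC⟩ := hg.2 k
  refine ⟨K * C, fun z => ?_⟩
  calc (1 + ‖z.2‖) ^ k * ‖f z‖ ≤ (1 + ‖z.2‖) ^ k * (K * ‖g z‖) := by gcongr; exact h z
    _ = K * ((1 + ‖z.2‖) ^ k * ‖g z‖) := by ring
    _ ≤ K * C := by gcongr; exact hC z

theorem of_exp {f : ℝ × E → F} (hf : Measurable f) {C γ : ℝ} (hγ : 0 < γ)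
    (h : ∀ z, ‖f z‖ ≤ C * Real.exp (-γ * ‖z.2‖)) : RapidDecay f := by
  refine ⟨hf, fun k => ⟨(k.factorial / γ ^ k * Real.exp γ) * C, fun z => ?_⟩⟩
  have h1 := Real.pow_div_factorial_le_exp (γ * (1 + ‖z.2‖)) (by positivity) k
  have h2 : (1 + ‖z.2‖) ^ k ≤ k.factorial / γ ^ k * Real.exp γ * Real.exp (γ * ‖z.2‖) := by
    rw [div_le_iff₀ (by positivity), mul_pow, mul_add, mul_one, Real.exp_add] at h1
    rw [mul_assoc, div_mul_eq_mul_div, le_div_iff₀ (by positivity)]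
    linarith
  calc (1 + ‖z.2‖) ^ k * ‖f z‖
      ≤ (k.factorial / γ ^ k * Real.exp γ * Real.exp (γ * ‖z.2‖)) *
        (C * Real.exp (-γ * ‖z.2‖)) := by gcongr; exact h z
    _ = (k.factorial / γ ^ k * Real.exp γ) * C *
        (Real.exp (γ * ‖z.2‖) * Real.exp (-γ * ‖z.2‖)) := by ring
    _ = _ := by rw [← Real.exp_add]; simp

theorem bounded {f : ℝ × E → F} (hf : RapidDecay f) : ∃ C, 0 ≤ C ∧ ∀ z, ‖f z‖ ≤ C := by
  obtain ⟨C, hC⟩ := hf.2 0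
  exact ⟨C, (mul_nonneg (by positivity) (norm_nonneg _)).trans (hC 0), fun z => by simpa using hC z⟩

theorem add {f g : ℝ × E → ℝ} (hf : RapidDecay f) (hg : RapidDecay g) :
    RapidDecay fun z => f z + g z := by
  refine ⟨hf.1.add hg.1, fun k => ?_⟩
  obtain ⟨C, hC⟩ := hf.2 k
  obtain ⟨D, hD⟩ := hg.2 k
  refine ⟨C + D, fun z => ?_⟩
  calc (1 + ‖z.2‖) ^ k * ‖f z + g z‖ ≤ (1 + ‖z.2‖) ^ k * (‖f z‖ + ‖g z‖) := by
        gcongr; exact norm_add_le _ _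
    _ ≤ C + D := by rw [mul_add]; exact add_le_add (hC z) (hD z)

theorem const_mul {f : ℝ × E → ℝ} (hf : RapidDecay f) (c : ℝ) : RapidDecay fun z => c * f z :=
  hf.of_le (hf.1.const_mul c) (norm_nonneg c) fun _ => (norm_mul _ _).le

theorem sum {ι : Type*} (s : Finset ι) {f : ι → ℝ × E → ℝ} (hf : ∀ i ∈ s, RapidDecay (f i)) :
    RapidDecay fun z => ∑ i ∈ s, f i z := by
  classical
  induction s using Finset.induction_on with
  | empty => exact ⟨by simp, fun k => ⟨0, by simp⟩⟩
  | insert a s ha ih =>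
    simp only [Finset.sum_insert ha]
    exact (hf a (by simp)).add (ih fun i hi => hf i (by simp [hi]))

theorem inner {f g : ℝ × E → ℂ} (hf : RapidDecay f) (hg : RapidDecay g) :
    RapidDecay fun z => Inner.inner ℝ (f z) (g z) := by
  obtain ⟨C, hC0, hC⟩ := hf.bounded
  exact hg.of_le (hf.1.inner hg.1) hC0 fun z =>
    (norm_inner_le_norm _ _).trans (by gcongr; exact hC z)

theorem I_mul {f : ℝ × E → ℂ} (hf : RapidDecay f) : RapidDecay fun z => Complex.I * f z :=
  hf.of_le (hf.1.const_mul _) zero_le_one fun z => by simp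

theorem exists_integrable_bound [NormedSpace ℝ E] [FiniteDimensional ℝ E] [BorelSpace E]
    (μ : Measure E) [μ.IsAddHaarMeasure] {f : ℝ × E → ℝ} (hf : RapidDecay f) :
    ∃ bound : E → ℝ, Integrable bound μ ∧ ∀ t x, ‖f (t, x)‖ ≤ bound x := by
  obtain ⟨C, hC⟩ := hf.2 (Module.finrank ℝ E + 1)
  refine ⟨fun x => C * (1 + ‖x‖) ^ (-((Module.finrank ℝ E + 1 : ℕ) : ℝ)),
    (integrable_one_add_norm (by push_cast; linarith)).const_mul C, fun t x => ?_⟩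
  beta_reduce
  rw [Real.rpow_neg (by positivity), Real.rpow_natCast, ← div_eq_mul_inv,
    le_div_iff₀ (by positivity), mul_comm]
  exact hC (t, x)

theorem measurable_slice {f : ℝ × E → F} (hf : RapidDecay f) (t : ℝ) :
    Measurable fun x => f (t, x) :=
  hf.1.comp measurable_prodMk_left

theorem integrable_slice [NormedSpace ℝ E] [FiniteDimensional ℝ E] [BorelSpace E] {μ : Measure E}
    [μ.IsAddHaarMeasure] {f : ℝ × E → ℝ} (hf : RapidDecay f) (t : ℝ) :
    Integrable (fun x => f (t, x)) μ := by
  obtain ⟨b, hb, h⟩ := hf.exists_integrable_bound μ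
  exact hb.mono' (hf.measurable_slice t).aestronglyMeasurable (.of_forall (h t))

/-- The derivative of a rapidly decaying function in a spatial direction has zero integral. -/
theorem integral_lineDeriv_eq_zero [NormedSpace ℝ E] [FiniteDimensional ℝ E] [BorelSpace E]
    {μ : Measure E} [μ.IsAddHaarMeasure] {f f' : ℝ × E → ℝ} {v : E} (hf : RapidDecay f)
    (hf' : RapidDecay f') (h : ∀ z, HasLineDerivAt ℝ f (f' z) z (0, v)) (t : ℝ) :
    ∫ x, f' (t, x) ∂μ = 0 := by
  have := integral_bilinear_hasLineDerivAt_right_eq_neg_left_of_integrable (μ := μ) (v := v)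
    (f := fun _ => (1 : ℝ)) (f' := fun _ => 0) (g := fun x => f (t, x))
    (g' := fun x => f' (t, x)) (B := ContinuousLinearMap.mul ℝ ℝ) (by simp)
    (by simpa using hf'.integrable_slice t) (by simpa using hf.integrable_slice t)
    (fun x _ => hasDerivAt_const _ _)
    (fun x _ => by simpa [HasLineDerivAt] using h (t, x))
  simpa using this

end

theorem coord_mul {n : ℕ} {f : ℝ × EuclideanSpace ℝ (Fin n) → ℝ} (hf : RapidDecay f) (j : Fin n) :
    RapidDecay fun z : ℝ × EuclideanSpace ℝ (Fin n) => z.2 j * f z := by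
  refine ⟨Measurable.mul (by fun_prop) hf.1, fun k => ?_⟩
  obtain ⟨C, hC⟩ := hf.2 (k + 1)
  refine ⟨C, fun z => le_trans ?_ (hC z)⟩
  rw [norm_mul, pow_succ, mul_assoc]
  gcongr
  linarith [PiLp.norm_apply_le z.2 j]

end RapidDecay

/-- The chain rule for the primitive `s log s - s` of `log`, evaluated at `‖c‖²`; it holds
at the zeros of `c` too. -/
theorem hasDerivAt_normSq_mul_log_sub {c : ℝ → ℂ} {c' : ℂ} {s : ℝ} (hc : HasDerivAt c c' s) :
    HasDerivAt (fun r => ‖c r‖ ^ 2 * Real.log (‖c r‖ ^ 2) - ‖c r‖ ^ 2)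
      (2 * Real.log (‖c s‖ ^ 2) * inner ℝ (c s) c') s := by
  by_cases h0 : c s = 0
  · have h1 : (fun r => ‖c r‖) =O[nhds s] fun r => r - s := by
      have := hc.isBigO_sub.norm_left
      simpa [h0] using this
    have h2 : Filter.Tendsto (fun r => 2 * (‖c r‖ * Real.log ‖c r‖) - ‖c r‖) (nhds s) (nhds 0) := by
      have hcont : Continuous fun y : ℝ => 2 * (y * Real.log y) - y := by
        have := Real.continuous_mul_log
        fun_prop
      have := (hcont.continuousAt (x := ‖c s‖)).tendsto.comp hc.continuousAt.norm
      simpa [h0, Function.comp_def] using this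
    have h3 := h1.mul_isLittleO ((Asymptotics.isLittleO_one_iff ℝ).2 h2)
    rw [hasDerivAt_iff_isLittleO]
    refine (h3.congr (fun r => ?_) (fun r => ?_))
    · simp [h0]; ring
    · simp
  · have h1 := hc.norm_sq
    have h2 := (Real.hasDerivAt_mul_log (pow_ne_zero 2 (norm_ne_zero_iff.2 h0))).comp s h1
    convert! h2.sub h1 using 1
    ring

/-- The pointwise virial identity: for a solution, the time derivative of the virial density is
`2 |∇u|² + n |u|²` up to divergences. Here `x`, `u`, `ut`, `du`, `dut`, `ddu` are the values of the
position, of the solution and of its derivatives at a point, and `L = log |u|²`. -/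
theorem virial_pointwise {n : ℕ} (x : Fin n → ℝ) (u ut : ℂ) (L A : ℝ) (du dut : Fin n → ℂ)
    (ddu : Fin n → Fin n → ℂ) (heq : Complex.I * ut + ∑ j, ddu j j = L * u)
    (hsymm : ∀ j k, ddu j k = ddu k j)
    (hA : A = inner ℝ (Complex.I * u) ut + (‖u‖ ^ 2 * L - ‖u‖ ^ 2)
      + ∑ k, inner ℝ (du k) (du k)) :
    ∑ j, x j * (inner ℝ (Complex.I * ut) (du j) + inner ℝ (Complex.I * u) (dut j)) =
      2 * ∑ k, inner ℝ (du k) (du k) + n * ‖u‖ ^ 2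
      + (∑ j, (A + x j * (inner ℝ (Complex.I * du j) ut + inner ℝ (Complex.I * u) (dut j)
          + 2 * L * inner ℝ u (du j) + ∑ k, 2 * inner ℝ (du k) (ddu j k))))
      + -n * (∑ j, (inner ℝ (du j) (du j) + inner ℝ u (ddu j j)))
      + -2 * (∑ j, ∑ k, ((if j = k then inner ℝ (du j) (du k) else 0)
          + x k * (inner ℝ (ddu j j) (du k) + inner ℝ (du j) (ddu j k)))) := by
  have h1 : ∑ j, inner ℝ u (ddu j j) = inner ℝ u (∑ j, ddu j j) := (inner_sum _ _ _).symm
  have h2 : ∑ j, ∑ k, x k * inner ℝ (ddu j j) (du k)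
      = ∑ k, x k * inner ℝ (∑ j, ddu j j) (du k) := by
    rw [Finset.sum_comm]
    simp only [sum_inner, Finset.mul_sum]
  have h3 : ∑ j, ∑ k, x k * inner ℝ (du j) (ddu j k)
      = ∑ j, x j * ∑ k, inner ℝ (du k) (ddu j k) := by
    rw [Finset.sum_comm]
    simp only [Finset.mul_sum]
    exact Finset.sum_congr rfl fun j _ => Finset.sum_congr rfl fun k _ => by rw [hsymm]
  have hS : ∑ j, ddu j j = L * u - Complex.I * ut := by rw [← heq]; ring
  have h4 : ∀ j, inner ℝ (Complex.I * ut) (du j) = inner ℝ (Complex.I * du j) ut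
      + 2 * L * inner ℝ u (du j) - 2 * inner ℝ (∑ j, ddu j j) (du j) := by
    intro j
    rw [hS]
    simp [Complex.inner]
    ring
  have h5 : inner ℝ u (∑ j, ddu j j) = L * ‖u‖ ^ 2 + inner ℝ (Complex.I * u) ut := by
    rw [hS, ← real_inner_self_eq_norm_sq]
    simp only [Complex.inner]
    simp
    ring
  simp only [h4]
  simp only [mul_add, mul_sub, Finset.sum_add_distrib, Finset.sum_sub_distrib, h1, h2, h3, h5,
    Finset.sum_const, Finset.card_univ, Fintype.card_fin, nsmul_eq_mul, Finset.sum_ite_eq,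
    Finset.mem_univ, if_true, ← Finset.mul_sum]
  rw [hA]
  have h6 : ∀ f : Fin n → ℝ, ∑ j, x j * (2 * f j) = 2 * ∑ j, x j * f j := fun f => by
    rw [Finset.mul_sum]; exact Finset.sum_congr rfl fun j _ => by ring
  simp only [h6]
  ring

section

variable {E F : Type*} [NormedAddCommGroup E] [NormedSpace ℝ E]

theorem HasLineDerivAt.real_inner {f g : E → ℂ} {f' g' : ℂ} {z v : E}
    (hf : HasLineDerivAt ℝ f f' z v) (hg : HasLineDerivAt ℝ g g' z v) :
    HasLineDerivAt ℝ (fun y => (inner ℝ (f y) (g y) : ℝ)) (inner ℝ (f z) g' + inner ℝ f' (g z))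
      z v := by
  have := HasDerivAt.inner (𝕜 := ℝ) hf hg
  simp only [zero_smul, add_zero] at this
  exact this

theorem HasLineDerivAt.I_mul {f : E → ℂ} {f' : ℂ} {z v : E} (hf : HasLineDerivAt ℝ f f' z v) :
    HasLineDerivAt ℝ (fun y => Complex.I * f y) (Complex.I * f') z v :=
  HasDerivAt.const_mul Complex.I hf

theorem HasLineDerivAt.fun_add {f g : E → ℝ} {f' g' : ℝ} {z v : E}
    (hf : HasLineDerivAt ℝ f f' z v) (hg : HasLineDerivAt ℝ g g' z v) :
    HasLineDerivAt ℝ (fun y => f y + g y) (f' + g') z v :=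
  HasDerivAt.add hf hg

theorem HasLineDerivAt.fun_mul {f g : E → ℝ} {f' g' : ℝ} {z v : E}
    (hf : HasLineDerivAt ℝ f f' z v) (hg : HasLineDerivAt ℝ g g' z v) :
    HasLineDerivAt ℝ (fun y => f y * g y) (f' * g z + f z * g') z v := by
  have := HasDerivAt.mul hf hg
  simp only [zero_smul, add_zero] at this
  exact this

theorem HasLineDerivAt.fun_sum {ι : Type*} (s : Finset ι) {f : ι → E → ℝ} {f' : ι → ℝ} {z v : E}
    (hf : ∀ i ∈ s, HasLineDerivAt ℝ (f i) (f' i) z v) :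
    HasLineDerivAt ℝ (fun y => ∑ i ∈ s, f i y) (∑ i ∈ s, f' i) z v :=
  HasDerivAt.fun_sum hf

theorem HasLineDerivAt.normSq_mul_log_sub {f : E → ℂ} {f' : ℂ} {z v : E}
    (hf : HasLineDerivAt ℝ f f' z v) :
    HasLineDerivAt ℝ (fun y => ‖f y‖ ^ 2 * Real.log (‖f y‖ ^ 2) - ‖f y‖ ^ 2)
      (2 * Real.log (‖f z‖ ^ 2) * inner ℝ (f z) f') z v := by
  have := hasDerivAt_normSq_mul_log_sub hf
  simp only [zero_smul, add_zero] at this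
  exact this

theorem hasLineDerivAt_fderiv_apply [NormedAddCommGroup F] [NormedSpace ℝ F] {U : E → F} {z : E}
    (hU : DifferentiableAt ℝ (fderiv ℝ U) z) (v w : E) :
    HasLineDerivAt ℝ (fun y => fderiv ℝ U y w) (fderiv ℝ (fderiv ℝ U) z v w) z v := by
  have := HasDerivAt.clm_apply (hU.hasFDerivAt.hasLineDerivAt v) (hasDerivAt_const (0 : ℝ) w)
  simpa [HasLineDerivAt] using this

theorem hasLineDerivAt_coord {n : ℕ} (j k : Fin n) (z : ℝ × EuclideanSpace ℝ (Fin n)) :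
    HasLineDerivAt ℝ (fun y : ℝ × EuclideanSpace ℝ (Fin n) => y.2 k) (if j = k then 1 else 0) z
      (0, EuclideanSpace.single j 1) := by
  have : HasDerivAt (fun s : ℝ => z.2 k + s * if j = k then 1 else 0)
      (if j = k then 1 else 0) 0 := by
    simpa using ((hasDerivAt_id (0 : ℝ)).mul_const (if j = k then (1 : ℝ) else 0)).const_add (z.2 k)
  simpa [HasLineDerivAt, Pi.single_apply, eq_comm] using this

end

/-- Multiplication by `log ‖u‖²` is harmless next to a factor `u`, for bounded `u`. -/
theorem exists_bound_norm_mul_log {C : ℝ} :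
    ∃ K, 0 ≤ K ∧ ∀ z : ℂ, ‖z‖ ≤ C → ‖z‖ * |Real.log (‖z‖ ^ 2)| ≤ K := by
  obtain ⟨K, hK⟩ := (isCompact_Icc (a := (0 : ℝ)) (b := C)).exists_bound_of_continuousOn
    Real.continuous_mul_log.continuousOn
  refine ⟨2 * |K|, by positivity, fun z hz => ?_⟩
  have := (hK ‖z‖ ⟨norm_nonneg z, hz⟩).trans (le_abs_self K)
  rw [Real.norm_eq_abs, abs_mul, abs_norm] at this
  rw [Real.log_pow, abs_mul]
  norm_num
  linarith

section virial

variable {n : ℕ} {U : ℝ × EuclideanSpace ℝ (Fin n) → ℂ}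

/-- The virial identity for a smooth, rapidly decaying solution of the logarithmic NLS. -/
theorem hasDerivAt_virial (hU : ContDiff ℝ (⊤ : ℕ∞) U) (h0 : RapidDecay U)
    (h1 : ∀ v, RapidDecay fun z => fderiv ℝ U z v)
    (h2 : ∀ v w, RapidDecay fun z => fderiv ℝ (fderiv ℝ U) z v w)
    (heq : ∀ z, Complex.I * fderiv ℝ U z (1, 0)
      + ∑ j : Fin n, fderiv ℝ (fderiv ℝ U) z (0, EuclideanSpace.single j 1)
        (0, EuclideanSpace.single j 1) = Real.log (‖U z‖ ^ 2) * U z) (t : ℝ) :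
    HasDerivAt (fun s => ∫ x, ∑ j : Fin n, x j * inner ℝ (Complex.I * U (s, x))
        (fderiv ℝ U (s, x) (0, EuclideanSpace.single j 1)))
      (∫ x, (2 * ∑ j : Fin n, ‖fderiv ℝ U (t, x) (0, EuclideanSpace.single j 1)‖ ^ 2
        + n * ‖U (t, x)‖ ^ 2)) t := by
  let e : Fin n → ℝ × EuclideanSpace ℝ (Fin n) := fun j => (0, EuclideanSpace.single j 1)
  let D : ℝ × EuclideanSpace ℝ (Fin n) → ℝ × EuclideanSpace ℝ (Fin n) → ℂ :=
    fun v z => fderiv ℝ U z v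
  let DD : ℝ × EuclideanSpace ℝ (Fin n) → ℝ × EuclideanSpace ℝ (Fin n) →
    ℝ × EuclideanSpace ℝ (Fin n) → ℂ := fun v w z => fderiv ℝ (fderiv ℝ U) z v w
  have hl0 : ∀ v z, HasLineDerivAt ℝ U (D v z) z v := fun v z =>
    ((hU.differentiable (by simp)) z).hasFDerivAt.hasLineDerivAt v
  have hl1 : ∀ v w z, HasLineDerivAt ℝ (D w) (DD v w z) z v := fun v w z =>
    hasLineDerivAt_fderiv_apply
      (((hU.fderiv_right (m := 1) (by norm_cast)).differentiable (by simp)) z) v w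
  have hsymm : ∀ v w z, DD v w z = DD w v z := fun v w z =>
    (hU.contDiffAt.isSymmSndFDerivAt (by
      simpa using WithTop.coe_le_coe.2 (le_top : (2 : ℕ∞) ≤ ⊤))) v w
  -- the virial density
  let p := fun z : ℝ × EuclideanSpace ℝ (Fin n) =>
    ∑ j, z.2 j * inner ℝ (Complex.I * U z) (D (e j) z)
  let p' := fun z : ℝ × EuclideanSpace ℝ (Fin n) =>
    ∑ j, z.2 j * (inner ℝ (Complex.I * D (1, 0) z) (D (e j) z)
      + inner ℝ (Complex.I * U z) (DD (1, 0) (e j) z))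
  have hp : RapidDecay p := .sum _ fun j _ => (h0.I_mul.inner (h1 (e j))).coord_mul j
  have hp' : RapidDecay p' := .sum _ fun j _ =>
    (((h1 (1, 0)).I_mul.inner (h1 (e j))).add (h0.I_mul.inner (h2 (1, 0) (e j)))).coord_mul j
  have hpp' : ∀ t x, HasDerivAt (fun s => p (s, x)) (p' (t, x)) t := by
    intro t x
    have : HasLineDerivAt ℝ p (p' (t, x)) (t, x) (1, 0) := by
      refine .fun_sum _ fun j _ => ?_
      have hx : HasLineDerivAt ℝ (fun y : ℝ × EuclideanSpace ℝ (Fin n) => y.2 j) 0 (t, x) (1, 0) := by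
        simpa [HasLineDerivAt] using hasDerivAt_const (0 : ℝ) (x j)
      convert! hx.fun_mul ((hl0 (1, 0) (t, x)).I_mul.real_inner (hl1 (1, 0) (e j) (t, x))) using 1
      ring
    have h3 := HasDerivAt.comp_sub_const t t (f := fun s => p ((t, x) + s • (1, 0)))
      (f' := p' (t, x)) (by simpa [HasLineDerivAt] using this)
    simpa using h3
  obtain ⟨b, hb, hbound⟩ := hp'.exists_integrable_bound (volume : Measure (EuclideanSpace ℝ (Fin n)))
  have hderiv := (hasDerivAt_integral_of_dominated_loc_of_deriv_le (μ := volume)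
    (F := fun s x => p (s, x)) (F' := fun s x => p' (s, x)) (bound := b) (x₀ := t)
    Filter.univ_mem (.of_forall fun s => (hp.measurable_slice s).aestronglyMeasurable)
    (hp.integrable_slice t) (hp'.measurable_slice t).aestronglyMeasurable
    (.of_forall fun x s _ => hbound s x) hb (.of_forall fun x s _ => hpp' s x)).2
  -- the divergence terms
  obtain ⟨C, -, hC⟩ := h0.bounded
  obtain ⟨K, hK0, hK⟩ := exists_bound_norm_mul_log (C := C)
  have hlogm : Measurable fun z => Real.log (‖U z‖ ^ 2) :=
    Real.measurable_log.comp (h0.1.norm.pow_const 2)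
  have hlog : RapidDecay fun z => ‖U z‖ ^ 2 * Real.log (‖U z‖ ^ 2) - ‖U z‖ ^ 2 := by
    refine h0.of_le (((h0.1.norm.pow_const 2).mul hlogm).sub (h0.1.norm.pow_const 2))
      (K := K + |C|) (by positivity) fun z => ?_
    have h3 := hK (U z) (hC z)
    have h4 := (hC z).trans (le_abs_self C)
    calc ‖‖U z‖ ^ 2 * Real.log (‖U z‖ ^ 2) - ‖U z‖ ^ 2‖
        ≤ ‖‖U z‖ ^ 2 * Real.log (‖U z‖ ^ 2)‖ + ‖‖U z‖ ^ 2‖ := norm_sub_le _ _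
      _ = (‖U z‖ * |Real.log (‖U z‖ ^ 2)| + ‖U z‖) * ‖U z‖ := by
        simp only [norm_mul, norm_pow, Real.norm_eq_abs, abs_norm]; ring
      _ ≤ _ := by gcongr
  have hlog' : ∀ j, RapidDecay fun z => 2 * Real.log (‖U z‖ ^ 2) * inner ℝ (U z) (D (e j) z) := by
    intro j
    refine (h1 (e j)).of_le ((hlogm.const_mul 2).mul (h0.1.inner (h1 (e j)).1))
      (K := 2 * K) (by positivity) fun z => ?_
    have h3 := hK (U z) (hC z)
    calc ‖2 * Real.log (‖U z‖ ^ 2) * inner ℝ (U z) (D (e j) z)‖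
        ≤ 2 * |Real.log (‖U z‖ ^ 2)| * (‖U z‖ * ‖D (e j) z‖) := by
          rw [norm_mul, norm_mul, Real.norm_eq_abs 2, abs_two, Real.norm_eq_abs]
          gcongr
          exact norm_inner_le_norm _ _
      _ = 2 * (‖U z‖ * |Real.log (‖U z‖ ^ 2)|) * ‖D (e j) z‖ := by ring
      _ ≤ _ := by gcongr
  let A := fun z => inner ℝ (Complex.I * U z) (D (1, 0) z)
    + (‖U z‖ ^ 2 * Real.log (‖U z‖ ^ 2) - ‖U z‖ ^ 2) + ∑ k, inner ℝ (D (e k) z) (D (e k) z)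
  let A' := fun j z => inner ℝ (Complex.I * D (e j) z) (D (1, 0) z)
    + inner ℝ (Complex.I * U z) (DD (1, 0) (e j) z)
    + 2 * Real.log (‖U z‖ ^ 2) * inner ℝ (U z) (D (e j) z)
    + ∑ k, 2 * inner ℝ (D (e k) z) (DD (e j) (e k) z)
  let W₁ := fun j z => A z + z.2 j * A' j z
  let W₂ := fun j z => inner ℝ (D (e j) z) (D (e j) z) + inner ℝ (U z) (DD (e j) (e j) z)
  let W₃ := fun j k (z : ℝ × EuclideanSpace ℝ (Fin n)) =>
    (if j = k then inner ℝ (D (e j) z) (D (e k) z) else 0)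
    + z.2 k * (inner ℝ (DD (e j) (e j) z) (D (e k) z) + inner ℝ (D (e j) z) (DD (e j) (e k) z))
  have hA : RapidDecay A :=
    ((h0.I_mul.inner (h1 _)).add hlog).add (.sum _ fun k _ => (h1 _).inner (h1 _))
  have hA' : ∀ j, RapidDecay (A' j) := fun j =>
    ((((h1 _).I_mul.inner (h1 _)).add (h0.I_mul.inner (h2 _ _))).add (hlog' j)).add
      (.sum _ fun k _ => ((h1 _).inner (h2 _ _)).const_mul 2)
  have hW₁ : ∀ j, RapidDecay (W₁ j) := fun j => hA.add ((hA' j).coord_mul j)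
  have hW₂ : ∀ j, RapidDecay (W₂ j) := fun j =>
    ((h1 (e j)).inner (h1 (e j))).add (h0.inner (h2 (e j) (e j)))
  have hW₃ : ∀ j k, RapidDecay (W₃ j k) := by
    intro j k
    have h3 := ((h2 (e j) (e j)).inner (h1 (e k))).add ((h1 (e j)).inner (h2 (e j) (e k)))
    have h4 := (h1 (e j)).inner (h1 (e k))
    by_cases hjk : j = k
    · simpa only [W₃, hjk, if_true] using h4.add (h3.coord_mul k)
    · simpa only [W₃, hjk, if_false, zero_add] using h3.coord_mul k
  have hI₁ : ∀ j, ∫ x, W₁ j (t, x) = 0 := by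
    refine fun j => (hA.coord_mul j).integral_lineDeriv_eq_zero (hW₁ j)
      (v := EuclideanSpace.single j 1) (fun z => ?_) t
    have hAd : HasLineDerivAt ℝ A (A' j z) z (e j) := by
      convert! (((hl0 (e j) z).I_mul.real_inner (hl1 (e j) (1, 0) z)).fun_add
        (hl0 (e j) z).normSq_mul_log_sub).fun_add (.fun_sum Finset.univ fun k _ =>
          (hl1 (e j) (e k) z).real_inner (hl1 (e j) (e k) z)) using 1
      simp only [A', hsymm (1, 0) (e j)]
      congr 1
      · ring
      · exact Finset.sum_congr rfl fun k _ => by rw [real_inner_comm (D (e k) z)]; ring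
    convert! (hasLineDerivAt_coord j j z).fun_mul hAd using 1
    simp [W₁]
  have hI₂ : ∀ j, ∫ x, W₂ j (t, x) = 0 := by
    refine fun j => (h0.inner (h1 (e j))).integral_lineDeriv_eq_zero (hW₂ j)
      (v := EuclideanSpace.single j 1) (fun z => ?_) t
    convert! (hl0 (e j) z).real_inner (hl1 (e j) (e j) z) using 1
    simp only [W₂]
    ring
  have hI₃ : ∀ j k, ∫ x, W₃ j k (t, x) = 0 := by
    refine fun j k => (((h1 (e j)).inner (h1 (e k))).coord_mul k).integral_lineDeriv_eq_zero
      (hW₃ j k) (v := EuclideanSpace.single j 1) (fun z => ?_) t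
    convert! (hasLineDerivAt_coord j k z).fun_mul
      ((hl1 (e j) (e j) z).real_inner (hl1 (e j) (e k) z)) using 1
    simp only [W₃, ite_mul, one_mul, zero_mul]
    ring
  let Q := fun z => 2 * ∑ k, inner ℝ (D (e k) z) (D (e k) z) + n * inner ℝ (U z) (U z)
  have hQ : RapidDecay Q := ((RapidDecay.sum _ fun k _ =>
    (h1 (e k)).inner (h1 (e k))).const_mul 2).add ((h0.inner h0).const_mul n)
  have hS₁ : RapidDecay fun z => ∑ j, W₁ j z := .sum _ fun j _ => hW₁ j
  have hS₂ : RapidDecay fun z => -(n : ℝ) * ∑ j, W₂ j z :=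
    (RapidDecay.sum _ fun j _ => hW₂ j).const_mul _
  have hS₃ : RapidDecay fun z => -2 * ∑ j, ∑ k, W₃ j k z :=
    (RapidDecay.sum _ fun j _ => RapidDecay.sum _ fun k _ => hW₃ j k).const_mul _
  have hid : ∀ z, p' z = Q z + ∑ j, W₁ j z + -(n : ℝ) * ∑ j, W₂ j z
      + -2 * ∑ j, ∑ k, W₃ j k z := fun z => by
    have := virial_pointwise z.2 (U z) (D (1, 0) z) (Real.log (‖U z‖ ^ 2)) (A z)
      (fun j => D (e j) z) (fun j => DD (1, 0) (e j) z) (fun j k => DD (e j) (e k) z) (heq z)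
      (fun j k => hsymm _ _ _) rfl
    simpa only [Q, real_inner_self_eq_norm_sq (U z)] using this
  have hint : ∫ x, p' (t, x) = ∫ x, Q (t, x) := by
    simp only [hid]
    rw [integral_add (((hQ.add hS₁).add hS₂).integrable_slice t) (hS₃.integrable_slice t),
      integral_add ((hQ.add hS₁).integrable_slice t) (hS₂.integrable_slice t),
      integral_add (hQ.integrable_slice t) (hS₁.integrable_slice t),
      integral_const_mul, integral_const_mul,
      integral_finsetSum _ fun j _ => (hW₁ j).integrable_slice t,
      integral_finsetSum _ fun j _ => (hW₂ j).integrable_slice t,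
      integral_finsetSum _ fun j _ =>
        (RapidDecay.sum Finset.univ fun k _ => hW₃ j k).integrable_slice t]
    simp only [integral_finsetSum _ fun k _ => (hW₃ _ k).integrable_slice t, hI₁, hI₂, hI₃]
    simp
  rw [hint] at hderiv
  simpa only [Q, real_inner_self_eq_norm_sq] using hderiv

end virial

theorem fderiv_slice {E F : Type*} [NormedAddCommGroup E] [NormedSpace ℝ E] [NormedAddCommGroup F]
    [NormedSpace ℝ F] {f : ℝ × E → F} {t : ℝ} {x : E} (hf : DifferentiableAt ℝ f (t, x)) (v : E) :
    fderiv ℝ (fun y => f (t, y)) x v = fderiv ℝ f (t, x) (0, v) := by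
  have := hf.hasFDerivAt.comp x (hasFDerivAt_prodMk_right t x)
  rw [show (fun y => f (t, y)) = f ∘ fun y => (t, y) from rfl, this.fderiv]
  simp

theorem Monotone.eq_of_periodic {P : ℝ → ℝ} (hP : Monotone P) {T : ℝ} (hper : Function.Periodic P T)
    (hT : 0 < T) (s t : ℝ) : P s = P t := by
  suffices h : ∀ s t, P t ≤ P s from le_antisymm (h t s) (h s t)
  intro s t
  obtain ⟨k, hk⟩ := exists_nat_ge ((t - s) / T)
  rw [div_le_iff₀ hT] at hk
  calc P t ≤ P (s + k * T) := hP (by linarith)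
    _ = P s := hper.nat_mul k s

/-- **Nonexistence of breathers for the defocusing logarithmic NLS.**
A smooth, exponentially localized, time-periodic solution of
`i ∂ₜ u + Δ u = log(|u|²) u` is identically zero. -/
theorem no_defocusing_logNLS_breather (n : ℕ) (hn : 1 ≤ n)
    (u : ℝ → EuclideanSpace ℝ (Fin n) → ℂ)
    (hsmooth : ContDiff ℝ (⊤ : ℕ∞) (Function.uncurry u))
    (heq : ∀ (t : ℝ) (x : EuclideanSpace ℝ (Fin n)),
      Complex.I * deriv (fun s => u s x) t + lap (u t) x = Flog (u t x))
    (hloc : ∃ C > 0, ∃ γ > 0, ∀ k : ℕ, k ≤ 2 → ∀ (t : ℝ) (x : EuclideanSpace ℝ (Fin n)),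
      ‖iteratedFDeriv ℝ k (Function.uncurry u) (t, x)‖ ≤ C * Real.exp (-γ * ‖x‖))
    (hper : ∃ T > 0, ∀ (t : ℝ) (x : EuclideanSpace ℝ (Fin n)), u (t + T) x = u t x) :
    ∀ t x, u t x = 0 := by
  obtain ⟨C, hC, γ, hγ, hbd⟩ := hloc
  obtain ⟨T, hT, hper⟩ := hper
  set U := Function.uncurry u with hUdef
  have hdiff : Differentiable ℝ U := hsmooth.differentiable (by simp)
  have hsmooth₁ : ContDiff ℝ 1 (fderiv ℝ U) := hsmooth.fderiv_right (m := 1) (by norm_cast)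
  have hdiff₁ : Differentiable ℝ (fderiv ℝ U) := hsmooth₁.differentiable (by simp)
  have hcont₁ : ∀ v, Continuous fun z => fderiv ℝ U z v := fun v =>
    hsmooth₁.continuous.clm_apply continuous_const
  have hcont₂ : ∀ v w, Continuous fun z => fderiv ℝ (fderiv ℝ U) z v w := fun v w =>
    ((hsmooth₁.continuous_fderiv (by simp)).clm_apply continuous_const).clm_apply continuous_const
  have h0 : RapidDecay U := .of_exp hsmooth.continuous.measurable hγ fun z => by
    simpa using hbd 0 (by norm_num) z.1 z.2
  have h1 : ∀ v, RapidDecay fun z => fderiv ℝ U z v := fun v =>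
    .of_exp (hcont₁ v).measurable (C := C * ‖v‖) hγ fun z => by
      have := hbd 1 (by norm_num) z.1 z.2
      rw [norm_iteratedFDeriv_one] at this
      calc ‖fderiv ℝ U z v‖ ≤ ‖fderiv ℝ U z‖ * ‖v‖ := ContinuousLinearMap.le_opNorm _ _
        _ ≤ C * Real.exp (-γ * ‖z.2‖) * ‖v‖ := by gcongr
        _ = _ := by ring
  have h2 : ∀ v w, RapidDecay fun z => fderiv ℝ (fderiv ℝ U) z v w := fun v w =>
    .of_exp (hcont₂ v w).measurable (C := C * ‖v‖ * ‖w‖) hγ fun z => by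
      have := hbd 2 le_rfl z.1 z.2
      rw [← norm_iteratedFDeriv_fderiv, norm_iteratedFDeriv_one] at this
      calc ‖fderiv ℝ (fderiv ℝ U) z v w‖ ≤ ‖fderiv ℝ (fderiv ℝ U) z‖ * ‖v‖ * ‖w‖ :=
            ContinuousLinearMap.le_opNorm₂ _ _ _
        _ ≤ C * Real.exp (-γ * ‖z.2‖) * ‖v‖ * ‖w‖ := by gcongr
        _ = _ := by ring
  have hpd : ∀ t j x, pd (u t) j x = fderiv ℝ U (t, x) (0, EuclideanSpace.single j 1) :=
    fun t j x => fderiv_slice (hdiff (t, x)) _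
  have heqU : ∀ z, Complex.I * fderiv ℝ U z (1, 0)
      + ∑ j : Fin n, fderiv ℝ (fderiv ℝ U) z (0, EuclideanSpace.single j 1)
        (0, EuclideanSpace.single j 1) = Real.log (‖U z‖ ^ 2) * U z := by
    rintro ⟨t, x⟩
    have ht : deriv (fun s => u s x) t = fderiv ℝ U (t, x) (1, 0) := by
      have h3 : HasDerivAt (fun s : ℝ => (s, x)) (1, 0) t :=
        (hasDerivAt_id t).prodMk (hasDerivAt_const t x)
      exact ((hdiff (t, x)).hasFDerivAt.comp_hasDerivAt t h3).deriv
    have hx : lap (u t) x = ∑ j : Fin n, fderiv ℝ (fderiv ℝ U) (t, x)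
        (0, EuclideanSpace.single j 1) (0, EuclideanSpace.single j 1) := by
      refine Finset.sum_congr rfl fun j _ => ?_
      simp only [hpd]
      have h3 := ((hdiff₁ (t, x)).hasFDerivAt.clm_apply
        (hasFDerivAt_const ((0, EuclideanSpace.single j 1) : ℝ × EuclideanSpace ℝ (Fin n)) (t, x)))
      rw [pd, fderiv_slice h3.differentiableAt, h3.fderiv]
      simp
    have h3 := heq t x
    rw [ht, hx] at h3
    rw [h3]
    change Flog (u t x) = Real.log (‖u t x‖ ^ 2) * u t x
    by_cases hu : u t x = 0
    · simp [Flog, hu]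
    · rw [Flog, if_neg hu, mul_comm]
  have hP := hasDerivAt_virial hsmooth h0 h1 h2 heqU
  set P := fun s => ∫ x, ∑ j : Fin n, x j * inner ℝ (Complex.I * U (s, x))
        (fderiv ℝ U (s, x) (0, EuclideanSpace.single j 1)) with hPdef
  have hPper : Function.Periodic P T := fun s => by
    have hs : u (s + T) = u s := funext (hper s)
    have hd : ∀ s (v : EuclideanSpace ℝ (Fin n)) x, fderiv ℝ U (s, x) (0, v) = fderiv ℝ (u s) x v :=
      fun s v x => (fderiv_slice (hdiff (s, x)) v).symm
    simp only [hPdef, hd]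
    simp only [hUdef, Function.uncurry_apply_pair, hs]
  have hmono : Monotone P := monotone_of_hasDerivAt_nonneg hP fun s =>
    integral_nonneg fun x => by positivity
  intro t x
  have hzero : ∫ x, (2 * ∑ j : Fin n, ‖fderiv ℝ U (t, x) (0, EuclideanSpace.single j 1)‖ ^ 2
      + n * ‖U (t, x)‖ ^ 2) = 0 :=
    by
    have hconst : P = fun _ => P 0 := funext fun s => hmono.eq_of_periodic hPper hT s 0
    exact (hP t).unique (hconst ▸ hasDerivAt_const t (P 0))
  have hQ : RapidDecay fun z => 2 * ∑ j : Fin n, ‖fderiv ℝ U z (0, EuclideanSpace.single j 1)‖ ^ 2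
      + n * ‖U z‖ ^ 2 := by
    simp only [← real_inner_self_eq_norm_sq]
    exact ((RapidDecay.sum _ fun j _ => (h1 _).inner (h1 _)).const_mul 2).add
      ((h0.inner h0).const_mul n)
  have hQc : Continuous fun x => 2 * ∑ j : Fin n,
      ‖fderiv ℝ U (t, x) (0, EuclideanSpace.single j 1)‖ ^ 2 + n * ‖U (t, x)‖ ^ 2 := by
    have h3 : ∀ v, Continuous fun x => fderiv ℝ U (t, x) v := fun v =>
      (hcont₁ v).comp (.prodMk_right t)
    have h4 : Continuous fun x => U (t, x) := hsmooth.continuous.comp (.prodMk_right t)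
    fun_prop
  rw [integral_eq_zero_iff_of_nonneg (fun x => by positivity) (hQ.integrable_slice t),
    hQc.ae_eq_iff_eq _ continuous_zero] at hzero
  have h3 := congrFun hzero x
  have h4 : 0 ≤ ∑ j : Fin n, ‖fderiv ℝ U (t, x) (0, EuclideanSpace.single j 1)‖ ^ 2 := by positivity
  have h5 : (1 : ℝ) ≤ n := by exact_mod_cast hn
  have h6 : ‖U (t, x)‖ ^ 2 = 0 := by
    simp only [Pi.zero_apply] at h3
    nlinarith [sq_nonneg ‖U (t, x)‖]
  simpa [hUdef] using h6
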